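/- arXiv:math/0204049 — 4 statements merged into one kernel-verified Lean document; each statement's English description precedes it below -/
import Mathlib

section
/- Let f be a continuous convex real function on an interval I ⊆ ℝ with 0 ∈ I and f(0) ≤ 0. Then for all natural numbers m and n, Tr(f(Σ_{i=1}^n a_i* x_i a_i)) ≤ Tr(Σ_{i=1}^n a_i* f(x_i) a_i) for every n-tuple (x_1, …, x_n) of self-adjoint m×m complex matrices with spectra contained in I and every n-tuple (a_1, …, a_n) of m×m complex matrices with Σ_{k=1}^n a_k* a_k ≤ 1 (in the Loewner order). -/
open scoped ComplexOrder

open Matrix in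
lemma Matrix.IsHermitian.star_mul_cfc_mul_apply_self {m : Type*} [Fintype m] [DecidableEq m]
    {x : Matrix m m ℂ} (hx : x.IsHermitian) (h : ℝ → ℝ) (b : Matrix m m ℂ) (j : m) :
    (star b * cfc h x * b) j j =
      ((∑ k, ‖(star (hx.eigenvectorUnitary : Matrix m m ℂ) * b) k j‖ ^ 2 *
        h (hx.eigenvalues k) : ℝ) : ℂ) := by
  set V : Matrix m m ℂ := (hx.eigenvectorUnitary : Matrix m m ℂ) with hV
  have key : star b * cfc h x * b =
      star (star V * b) * diagonal (fun k => (h (hx.eigenvalues k) : ℂ)) * (star V * b) := by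
    rw [hx.cfc_eq, Matrix.IsHermitian.cfc, Unitary.conjStarAlgAut_apply, star_mul, star_star]
    simp only [mul_assoc]
    rfl
  rw [key, Matrix.mul_apply]
  push_cast
  refine Finset.sum_congr rfl fun k _ => ?_
  rw [mul_diagonal, star_apply, mul_right_comm, ← Complex.conj_mul']
  rfl

open Matrix in
lemma Matrix.trace_star_unitary_mul_mul {m : Type*} [Fintype m] [DecidableEq m]
    (U : unitaryGroup m ℂ) (y : Matrix m m ℂ) :
    (star (U : Matrix m m ℂ) * y * (U : Matrix m m ℂ)).trace = y.trace := by
  rw [trace_mul_comm, ← mul_assoc, Unitary.mul_star_self_of_mem U.2, one_mul]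

open Matrix in
lemma Matrix.IsHermitian.star_eigenvectorUnitary_mul_cfc_mul {m : Type*} [Fintype m]
    [DecidableEq m] {y : Matrix m m ℂ} (hy : y.IsHermitian) (h : ℝ → ℝ) :
    star (hy.eigenvectorUnitary : Matrix m m ℂ) * cfc h y *
      (hy.eigenvectorUnitary : Matrix m m ℂ) =
      diagonal (fun k => (h (hy.eigenvalues k) : ℂ)) := by
  rw [hy.cfc_eq, Matrix.IsHermitian.cfc, Unitary.conjStarAlgAut_apply]
  simp only [mul_assoc, Unitary.coe_star_mul_self, mul_one]
  rw [← mul_assoc, Unitary.coe_star_mul_self, one_mul]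
  rfl

lemma ConvexOn.map_sum_le_of_sum_le_one {ι : Type*} {f : ℝ → ℝ} {I : Set ℝ}
    (hf : ConvexOn ℝ I f) (h0 : (0 : ℝ) ∈ I) (hf0 : f 0 ≤ 0) (t : Finset ι) {w p : ι → ℝ}
    (hw : ∀ i ∈ t, 0 ≤ w i) (hw1 : ∑ i ∈ t, w i ≤ 1) (hp : ∀ i ∈ t, p i ∈ I) :
    f (∑ i ∈ t, w i * p i) ≤ ∑ i ∈ t, w i * f (p i) := by
  have h := hf.map_add_sum_le (v := 1 - ∑ i ∈ t, w i) (q := 0) hw (by ring) hp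
    (sub_nonneg.2 hw1) h0
  simp only [smul_eq_mul, mul_zero, zero_add] at h
  linarith [mul_nonpos_of_nonneg_of_nonpos (sub_nonneg.2 hw1) hf0]

/-- **Jensen's trace inequality, contractive version (Corollary 2.5).**  Let `f` be a
continuous convex function on an interval `I ⊆ ℝ` with `0 ∈ I` and `f(0) ≤ 0`.  Then for all
natural numbers `m` and `n`, `Tr(f(∑ aᵢ* xᵢ aᵢ)) ≤ Tr(∑ aᵢ* f(xᵢ) aᵢ)` for every `n`-tuple
`(x₁, …, xₙ)` of self-adjoint `m × m` complex matrices with spectra in `I` and every `n`-tuple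
`(a₁, …, aₙ)` of `m × m` complex matrices with `∑ aₖ* aₖ ≤ 1` in the Loewner order. -/
theorem jensen_trace_inequality_contractive
    (f : ℝ → ℝ) (I : Set ℝ) (hI : I.OrdConnected) (hf : ContinuousOn f I)
    (hconv : ConvexOn ℝ I f) (h0 : (0 : ℝ) ∈ I) (hf0 : f 0 ≤ 0) (m n : ℕ)
    (x a : Fin n → Matrix (Fin m) (Fin m) ℂ)
    (hx : ∀ i, (x i).IsHermitian) (hxI : ∀ i, spectrum ℝ (x i) ⊆ I)
    (ha : (1 - ∑ k, star (a k) * a k).PosSemidef) :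
    (cfc f (∑ i, star (a i) * x i * a i)).trace ≤
      (∑ i, star (a i) * cfc f (x i) * a i).trace := by
  set y := ∑ i, star (a i) * x i * a i with hy_def
  have hy : y.IsHermitian := by
    rw [Matrix.IsHermitian, ← Matrix.star_eq_conjTranspose, hy_def, star_sum]
    refine Finset.sum_congr rfl fun i _ => ?_
    rw [star_mul, star_mul, star_star, Matrix.star_eq_conjTranspose (x i), (hx i).eq, mul_assoc]
  set U : Matrix (Fin m) (Fin m) ℂ := (hy.eigenvectorUnitary : Matrix (Fin m) (Fin m) ℂ) with hU
  have hUU : star U * U = 1 := Unitary.coe_star_mul_self _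
  let w (j : Fin m) (p : Fin n × Fin m) : ℝ :=
    ‖(star ((hx p.1).eigenvectorUnitary : Matrix (Fin m) (Fin m) ℂ) * (a p.1 * U)) p.2 j‖ ^ 2
  have hdiag (h : ℝ → ℝ) (j : Fin m) :
      (star U * (∑ i, star (a i) * cfc h (x i) * a i) * U) j j =
        ((∑ p, w j p * h ((hx p.1).eigenvalues p.2) : ℝ) : ℂ) := by
    rw [Finset.mul_sum, Finset.sum_mul, Matrix.sum_apply, Fintype.sum_prod_type,
      Complex.ofReal_sum]
    refine Finset.sum_congr rfl fun i _ => ?_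
    rw [← (hx i).star_mul_cfc_mul_apply_self h (a i * U) j, star_mul]
    simp only [mul_assoc]
  have hsum (j : Fin m) : ∑ p, w j p ≤ 1 := by
    have h1 := hdiag (fun _ => 1) j
    have h2 := (ha.conjTranspose_mul_mul_same U).diag_nonneg (i := j)
    simp only [fun i => cfc_const_one ℝ (x i) (hx i).isSelfAdjoint, mul_one] at h1
    rw [← Matrix.star_eq_conjTranspose, mul_sub, sub_mul, mul_one, hUU, Matrix.sub_apply, h1,
      Matrix.one_apply_eq] at h2
    exact_mod_cast sub_nonneg.1 h2
  have heig (j : Fin m) :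
      hy.eigenvalues j = ∑ p, w j p * (hx p.1).eigenvalues p.2 := by
    have h1 := hdiag (fun t => t) j
    simp only [fun i => cfc_id' ℝ (x i) (hx i).isSelfAdjoint] at h1
    have h2 := congrFun (congrFun (hy.star_eigenvectorUnitary_mul_cfc_mul fun t => t) j) j
    rw [cfc_id' ℝ y hy.isSelfAdjoint, Matrix.diagonal_apply_eq] at h2
    exact_mod_cast h2.symm.trans h1
  rw [← Matrix.trace_star_unitary_mul_mul hy.eigenvectorUnitary (cfc f y),
    ← Matrix.trace_star_unitary_mul_mul hy.eigenvectorUnitary (∑ i, _),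
    hy.star_eigenvectorUnitary_mul_cfc_mul]
  refine Finset.sum_le_sum fun j _ => ?_
  rw [Matrix.diag_apply, Matrix.diag_apply, Matrix.diagonal_apply_eq, hdiag f j,
    Complex.real_le_real, heig j]
  exact hconv.map_sum_le_of_sum_le_one h0 hf0 _ (fun p _ => sq_nonneg _) (hsum j)
    fun p _ => hxI p.1 ((hx p.1).eigenvalues_mem_spectrum_real p.2)
end

section
/- Let f be a continuous convex real function on an interval I ⊆ ℝ with 0 ∈ I and f(0) ≤ 0. Then Tr(f(a* x a)) ≤ Tr(a* f(x) a) for every self-adjoint m×m complex matrix x with spectrum contained in I and every m×m complex matrix a with a* a ≤ 1 (Brown–Kosaki trace inequality for matrices). -/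
open scoped ComplexOrder

/-- A diagonal entry of `b* D b`, for `D` real diagonal, is a combination of the entries of `D`
weighted by the squared moduli of a column of `b`. -/
lemma star_mul_diagonal_mul_apply_self {n : Type*} [Fintype n] [DecidableEq n]
    (b : Matrix n n ℂ) (g : n → ℝ) (i : n) :
    (star b * Matrix.diagonal (fun j => (g j : ℂ)) * b) i i =
      ((∑ j, Complex.normSq (b j i) * g j : ℝ) : ℂ) := by
  rw [Matrix.mul_apply]
  push_cast
  refine Finset.sum_congr rfl fun j _ => ?_
  rw [Matrix.mul_diagonal, Matrix.star_apply, Complex.normSq_eq_conj_mul_self, Complex.star_def]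
  ring

/-- Jensen's inequality for weights of total mass at most one, when `f 0 ≤ 0`. -/
lemma ConvexOn.map_sum_le_of_sum_le_one_s10 {n : Type*} [Fintype n] {f : ℝ → ℝ} {I : Set ℝ}
    (hconv : ConvexOn ℝ I f) (h0 : (0 : ℝ) ∈ I) (hf0 : f 0 ≤ 0) {w e : n → ℝ}
    (hw : ∀ j, 0 ≤ w j) (hw1 : ∑ j, w j ≤ 1) (he : ∀ j, e j ∈ I) :
    f (∑ j, w j * e j) ≤ ∑ j, w j * f (e j) := by
  have h := hconv.map_sum_le (t := (Finset.univ : Finset (Option n)))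
    (w := fun o => o.elim (1 - ∑ j, w j) w) (p := fun o => o.elim 0 e)
    (by rintro (_ | j) _
        · simpa using hw1
        · exact hw j)
    (by simp [Fintype.sum_option])
    (by rintro (_ | j) _
        · exact h0
        · exact he j)
  simp only [Fintype.sum_option, Option.elim, smul_eq_mul, mul_zero, zero_add] at h
  nlinarith

/-- **The Brown–Kosaki trace inequality for matrices.**  Let `f` be a continuous convex
function on an interval `I ⊆ ℝ` with `0 ∈ I` and `f(0) ≤ 0`.  Then
`Tr(f(a* x a)) ≤ Tr(a* f(x) a)` for every self-adjoint `m × m` complex matrix `x` with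
spectrum in `I` and every `m × m` complex matrix `a` with `a* a ≤ 1` in the Loewner order. -/
theorem brown_kosaki_trace_inequality
    (f : ℝ → ℝ) (I : Set ℝ) (hI : I.OrdConnected) (hf : ContinuousOn f I)
    (hconv : ConvexOn ℝ I f) (h0 : (0 : ℝ) ∈ I) (hf0 : f 0 ≤ 0) (m : ℕ)
    (x a : Matrix (Fin m) (Fin m) ℂ)
    (hx : x.IsHermitian) (hxI : spectrum ℝ x ⊆ I)
    (ha : (1 - star a * a).PosSemidef) :
    (cfc f (star a * x * a)).trace ≤ (star a * cfc f x * a).trace := by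
  have hy : (star a * x * a).IsHermitian := by
    rw [Matrix.star_eq_conjTranspose]
    exact Matrix.isHermitian_conjTranspose_mul_mul a hx
  set U : Matrix (Fin m) (Fin m) ℂ := hx.eigenvectorUnitary.1
  set V : Matrix (Fin m) (Fin m) ℂ := hy.eigenvectorUnitary.1
  have hUU : U * star U = 1 := Unitary.coe_mul_star_self _
  have hVV : V * star V = 1 := Unitary.coe_mul_star_self _
  have hVV' : star V * V = 1 := Unitary.coe_star_mul_self _
  have hxd : x = U * Matrix.diagonal (fun j => (hx.eigenvalues j : ℂ)) * star U :=
    hx.spectral_theorem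
  have hyd : star a * x * a =
      V * Matrix.diagonal (fun j => (hy.eigenvalues j : ℂ)) * star V := hy.spectral_theorem
  have hfx : cfc f x = U * Matrix.diagonal (fun j => (f (hx.eigenvalues j) : ℂ)) * star U :=
    hx.cfc_eq f
  have hfy : cfc f (star a * x * a) =
      V * Matrix.diagonal (fun j => (f (hy.eigenvalues j) : ℂ)) * star V := hy.cfc_eq f
  set b := star U * a * V with hb
  have hconj (g : Fin m → ℝ) :
      star b * Matrix.diagonal (fun j => (g j : ℂ)) * b =
        star V * (star a * (U * Matrix.diagonal (fun j => (g j : ℂ)) * star U) * a) * V := by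
    simp only [hb, star_mul, star_star, mul_assoc]
  have heig (i : Fin m) :
      hy.eigenvalues i = ∑ j, Complex.normSq (b j i) * hx.eigenvalues j := by
    have h := star_mul_diagonal_mul_apply_self b hx.eigenvalues i
    rw [hconj, ← hxd, hyd, show ∀ D : Matrix (Fin m) (Fin m) ℂ,
      star V * (V * D * star V) * V = (star V * V) * D * (star V * V) by
        intro D; simp only [mul_assoc], hVV', one_mul, mul_one, Matrix.diagonal_apply_eq] at h
    exact_mod_cast h
  have hweight (i : Fin m) : ∑ j, Complex.normSq (b j i) ≤ 1 := by
    have h := star_mul_diagonal_mul_apply_self b (fun _ => 1) i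
    have hp := (ha.conjTranspose_mul_mul_same V).diag_nonneg (i := i)
    have hbb : V.conjTranspose * (1 - star a * a) * V = 1 - star b *
        Matrix.diagonal (fun _ => ((1 : ℝ) : ℂ)) * b := by
      rw [hconj]
      simp only [Complex.ofReal_one, Matrix.diagonal_one, mul_one, hUU,
        ← Matrix.star_eq_conjTranspose, mul_sub, sub_mul, hVV']
    rw [hbb, Matrix.sub_apply, h, Matrix.one_apply_eq] at hp
    simp only [mul_one] at hp
    have hp' := sub_nonneg.mp hp
    exact_mod_cast hp'
  have hl : (cfc f (star a * x * a)).trace = ((∑ i, f (hy.eigenvalues i) : ℝ) : ℂ) := by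
    rw [hfy, Matrix.trace_mul_cycle, hVV', one_mul, Matrix.trace_diagonal]
    push_cast
    rfl
  have hr : (star a * cfc f x * a).trace =
      ((∑ i, ∑ j, Complex.normSq (b j i) * f (hx.eigenvalues j) : ℝ) : ℂ) := by
    have h : (star a * cfc f x * a).trace =
        (star b * Matrix.diagonal (fun j => (f (hx.eigenvalues j) : ℂ)) * b).trace := by
      rw [hconj (fun j => f (hx.eigenvalues j)), ← hfx, Matrix.trace_mul_cycle (star V), hVV,
        one_mul]
    rw [h, Matrix.trace, Complex.ofReal_sum]
    exact Finset.sum_congr rfl fun i _ =>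
      star_mul_diagonal_mul_apply_self b (fun j => f (hx.eigenvalues j)) i
  rw [hl, hr]
  refine Complex.real_le_real.mpr (Finset.sum_le_sum fun i _ => ?_)
  rw [heig i]
  exact hconv.map_sum_le_of_sum_le_one_s10 h0 hf0 (fun j => Complex.normSq_nonneg _) (hweight i)
    fun j => hxI (hx.eigenvalues_mem_spectrum_real j)
end

section
/- Let f be a continuous convex real function on an interval I ⊆ ℝ, let A be a unital C*-algebra, and let τ : A → ℂ be a finite trace, i.e., a positive linear functional with τ(xy) = τ(yx) for all x, y ∈ A. Then τ(f(Σ_{i=1}^n a_i* x_i a_i)) ≤ τ(Σ_{i=1}^n a_i* f(x_i) a_i) for every n-tuple (x_1, …, x_n) of self-adjoint elements of A with spectra contained in I and every n-tuple (a_1, …, a_n) of elements of A with Σ_{k=1}^n a_k* a_k = 1. -/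
open scoped ComplexOrder

/-- A continuous convex function on a compact set of reals is, up to `ε`, a convex combination
(with continuously varying weights) of finitely many affine minorants. -/
theorem ConvexOn.exists_affine_minorants_partition {J : Set ℝ} (hJ : IsCompact J) {f : ℝ → ℝ}
    (hf : ContinuousOn f J) (hconv : ConvexOn ℝ J f) {ε : ℝ} (hε : 0 < ε) :
    ∃ (ι : Type) (_ : Fintype ι) (c d : ι → ℝ) (g : ι → ℝ → ℝ),
      (∀ j, Continuous (g j)) ∧ (∀ j t, 0 ≤ g j t) ∧
      (∀ j, ∀ t ∈ J, c j * t + d j ≤ f t) ∧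
      (∀ t ∈ J, ∑ j, g j t = 1) ∧
      ∀ t ∈ J, f t - ε ≤ ∑ j, g j t * (c j * t + d j) := by
  let P : Type := {p : ℝ × ℝ // ∀ t ∈ J, p.1 * t + p.2 ≤ f t}
  have hopen (p : P) : ∃ u : Set ℝ, IsOpen u ∧
      (fun t ↦ f t - (p.1.1 * t + p.1.2)) ⁻¹' Set.Iio ε ∩ J = u ∩ J :=
    continuousOn_iff'.1 (hf.sub (by fun_prop)) _ isOpen_Iio
  choose U hUo hU using hopen
  have hcover : J ⊆ ⋃ p, U p := by
    intro t ht
    obtain ⟨c, d, hle, heq⟩ := hconv.exists_affine_le_of_lt_real ht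
      (show f t - ε / 2 < f t by linarith) hJ.isClosed hf.lowerSemicontinuousOn
    refine Set.mem_iUnion.2 ⟨⟨(c, d), hle⟩, ?_⟩
    have hmem : t ∈ U ⟨(c, d), hle⟩ ∩ J := by
      rw [← hU]
      refine ⟨?_, ht⟩
      simp only [Set.mem_preimage, Set.mem_Iio]
      linarith
    exact hmem.1
  obtain ⟨s, hs⟩ := hJ.elim_finite_subcover U hUo hcover
  obtain ⟨g, hg⟩ := PartitionOfUnity.exists_isSubordinate hJ.isClosed
    (fun j : s ↦ U j.1) (fun j ↦ hUo j.1) (by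
      intro t ht
      obtain ⟨p, hp, htp⟩ := Set.mem_iUnion₂.1 (hs ht)
      exact Set.mem_iUnion.2 ⟨⟨p, hp⟩, htp⟩)
  have hsum : ∀ t ∈ J, ∑ j, g j t = 1 := fun t ht ↦ by
    rw [← finsum_eq_sum_of_fintype]
    exact g.sum_eq_one ht
  refine ⟨s, inferInstance, fun j ↦ j.1.1.1, fun j ↦ j.1.1.2, fun j ↦ g j,
    fun j ↦ (g j).continuous, fun j t ↦ g.nonneg j t, fun j ↦ j.1.2, hsum, fun t ht ↦ ?_⟩
  calc f t - ε = ∑ j, g j t * (f t - ε) := by rw [← Finset.sum_mul, hsum t ht, one_mul]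
    _ ≤ ∑ j, g j t * (j.1.1.1 * t + j.1.1.2) := by
      refine Finset.sum_le_sum fun j _ ↦ ?_
      by_cases hj : g j t = 0
      · simp [hj]
      · have hmem : t ∈ U j.1 ∩ J := ⟨hg j (subset_tsupport _ hj), ht⟩
        rw [← hU] at hmem
        have hlt := hmem.1
        simp only [Set.mem_preimage, Set.mem_Iio] at hlt
        exact mul_le_mul_of_nonneg_left (by linarith) (g.nonneg j t)

section CStarAlgebra

variable {A : Type*} [CStarAlgebra A]

/-- A tracial positive functional is nonnegative on products of positive elements. -/
theorem tracial_apply_mul_nonneg [PartialOrder A] [StarOrderedRing A] (τ : A →ₗ[ℂ] ℂ)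
    (hτpos : ∀ a : A, 0 ≤ τ (star a * a)) (hτtrace : ∀ x y : A, τ (x * y) = τ (y * x))
    {u v : A} (hu : 0 ≤ u) (hv : 0 ≤ v) : 0 ≤ τ (u * v) := by
  obtain ⟨b, rfl⟩ := CStarAlgebra.nonneg_iff_eq_star_mul_self.1 hu
  obtain ⟨c, rfl⟩ := CStarAlgebra.nonneg_iff_eq_star_mul_self.1 hv
  have h := hτpos (c * star b)
  rwa [star_mul, star_star, show b * star c * (c * star b) = (b * star c * c) * star b by
    simp only [mul_assoc], hτtrace, show star b * (b * star c * c) = star b * b * (star c * c) by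
    simp only [mul_assoc]] at h

/-- Unital column compressions preserve affine inequalities. -/
theorem affine_sum_conjugate_le [PartialOrder A] [StarOrderedRing A] {ι : Type*} [Fintype ι]
    {x z a : ι → A} (ha : ∑ k, star (a k) * a k = 1) {c d : ℝ}
    (h : ∀ i, c • x i + algebraMap ℝ A d ≤ z i) :
    c • (∑ i, star (a i) * x i * a i) + algebraMap ℝ A d ≤ ∑ i, star (a i) * z i * a i := by
  have key : c • (∑ i, star (a i) * x i * a i) + algebraMap ℝ A d =
      ∑ i, star (a i) * (c • x i + algebraMap ℝ A d) * a i := by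
    simp only [mul_add, add_mul, Finset.sum_add_distrib, Algebra.algebraMap_eq_smul_one,
      mul_smul_comm, smul_mul_assoc, mul_one, ← Finset.smul_sum, ha]
  rw [key]
  exact Finset.sum_le_sum fun i _ ↦ star_left_conjugate_le_conjugate (h i) (a i)

/-- If `v` dominates `ℓ(y)` for every affine minorant `ℓ` of the convex function `f` on a compact
set containing the spectrum of `y`, then `τ (f(y)) ≤ τ v` for every tracial positive `τ`. -/
theorem tracial_cfc_le_of_affine_le [PartialOrder A] [StarOrderedRing A] (τ : A →ₗ[ℂ] ℂ)
    (hτpos : ∀ a : A, 0 ≤ τ (star a * a)) (hτtrace : ∀ x y : A, τ (x * y) = τ (y * x))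
    {J : Set ℝ} (hJ : IsCompact J) {f : ℝ → ℝ} (hf : ContinuousOn f J)
    (hconv : ConvexOn ℝ J f) {y v : A} (hy : IsSelfAdjoint y) (hyJ : spectrum ℝ y ⊆ J)
    (h : ∀ c d : ℝ, (∀ t ∈ J, c * t + d ≤ f t) → c • y + algebraMap ℝ A d ≤ v) :
    τ (cfc f y) ≤ τ v := by
  have hτnonneg {u : A} (hu : 0 ≤ u) : 0 ≤ τ u := by
    simpa using tracial_apply_mul_nonneg τ hτpos hτtrace hu (zero_le_one' A)
  have hτmono {u w : A} (huw : u ≤ w) : τ u ≤ τ w := by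
    simpa using hτnonneg (sub_nonneg.2 huw)
  have approx (ε : ℝ) (hε : 0 < ε) : τ (cfc f y) ≤ τ v + ε * τ 1 := by
    obtain ⟨ι, _, c, d, g, hgc, hg0, hle, hsum, happ⟩ :=
      ConvexOn.exists_affine_minorants_partition hJ hf hconv hε
    have hg1 : ∑ j, cfc (g j) y = 1 := by
      rw [← cfc_sum_univ g y fun j ↦ (hgc j).continuousOn, ← cfc_const_one ℝ y]
      exact cfc_congr fun t ht ↦ by simpa using hsum t (hyJ ht)
    have hterm (j : ι) : cfc (fun t ↦ g j t * (c j * t + d j)) y =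
        cfc (g j) y * (c j • y + algebraMap ℝ A (d j)) := by
      rw [cfc_mul (g j) (fun t ↦ c j * t + d j) y (hgc j).continuousOn,
        cfc_add_const (d j) (fun t ↦ c j * t) y, cfc_const_mul_id (c j) y]
    have hlow : cfc f y - algebraMap ℝ A ε ≤
        ∑ j, cfc (g j) y * (c j • y + algebraMap ℝ A (d j)) := by
      have hcont (j : ι) : Continuous fun t ↦ g j t * (c j * t + d j) :=
        (hgc j).mul (by fun_prop)
      simp only [← hterm]
      rw [← cfc_sum_univ (fun j t ↦ g j t * (c j * t + d j)) y fun j ↦ (hcont j).continuousOn,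
        ← cfc_const ε y, ← cfc_sub f (fun _ ↦ ε) y (hf.mono hyJ)]
      refine cfc_mono (fun t ht ↦ by simpa using happ t (hyJ ht))
        ((hf.mono hyJ).sub continuousOn_const) ?_
      rw [Finset.sum_fn]
      exact (continuous_finsetSum _ fun j _ ↦ hcont j).continuousOn
    have hup : τ (∑ j, cfc (g j) y * (c j • y + algebraMap ℝ A (d j))) ≤ τ v := by
      have hv : v = ∑ j, cfc (g j) y * v := by rw [← Finset.sum_mul, hg1, one_mul]
      rw [hv, map_sum, map_sum]
      refine Finset.sum_le_sum fun j _ ↦ ?_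
      rw [← sub_nonneg, ← map_sub, ← mul_sub]
      exact tracial_apply_mul_nonneg τ hτpos hτtrace (cfc_nonneg fun t _ ↦ hg0 j t)
        (sub_nonneg.2 (h _ _ (hle j)))
    have htot := (hτmono hlow).trans hup
    rw [map_sub, sub_le_iff_le_add] at htot
    have hscal : τ (algebraMap ℝ A ε) = ε * τ 1 := by
      rw [Algebra.algebraMap_eq_smul_one, ← Complex.coe_smul, map_smul, smul_eq_mul]
    rwa [hscal] at htot
  refine ge_of_tendsto (x := nhdsWithin (0 : ℝ) (Set.Ioi 0))
    (f := fun ε : ℝ ↦ τ v + ε * τ 1) ?_ (eventually_mem_nhdsWithin.mono approx)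
  refine Filter.Tendsto.mono_left ?_ nhdsWithin_le_nhds
  exact Continuous.tendsto' (by fun_prop) _ _ (by simp)

end CStarAlgebra

/-- **Jensen's trace inequality for C*-algebras (Theorem 2.7).**  Let `f` be a continuous
convex function on an interval `I ⊆ ℝ`, let `A` be a unital C*-algebra, and let `τ : A → ℂ`
be a finite trace (a positive linear functional with `τ(xy) = τ(yx)`).  Then
`τ(f(∑ aᵢ* xᵢ aᵢ)) ≤ τ(∑ aᵢ* f(xᵢ) aᵢ)` for every `n`-tuple `(x₁, …, xₙ)` of self-adjoint
elements of `A` with spectra in `I` and every `n`-tuple `(a₁, …, aₙ)` in `A`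
with `∑ aₖ* aₖ = 1`. -/
theorem jensen_trace_inequality_cstar
    (f : ℝ → ℝ) (I : Set ℝ) (hI : I.OrdConnected) (hf : ContinuousOn f I)
    (hconv : ConvexOn ℝ I f)
    (A : Type) [CStarAlgebra A]
    (τ : A →ₗ[ℂ] ℂ) (hτpos : ∀ a : A, 0 ≤ τ (star a * a))
    (hτtrace : ∀ x y : A, τ (x * y) = τ (y * x))
    (n : ℕ) (x a : Fin n → A)
    (hx : ∀ i, IsSelfAdjoint (x i)) (hxI : ∀ i, spectrum ℝ (x i) ⊆ I)
    (ha : ∑ k, star (a k) * a k = 1) :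
    τ (cfc f (∑ i, star (a i) * x i * a i)) ≤ τ (∑ i, star (a i) * cfc f (x i) * a i) := by
  obtain hA | hA := subsingleton_or_nontrivial A
  · exact (congrArg τ (Subsingleton.elim _ _)).le
  let _ := CStarAlgebra.spectralOrder A
  have := CStarAlgebra.spectralOrderedRing A
  set y := ∑ i, star (a i) * x i * a i with hy_def
  have hy : IsSelfAdjoint y := by
    simp [hy_def, IsSelfAdjoint, star_sum, mul_assoc, (hx _).star_eq]
  let K : Set ℝ := ⋃ i, spectrum ℝ (x i)
  have hKc : IsCompact K := isCompact_iUnion fun i ↦ spectrum.isCompact (x i)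
  have hKI : K ⊆ I := Set.iUnion_subset hxI
  have hKne : K.Nonempty := by
    obtain _ | n := n
    · simp at ha
    · obtain ⟨t, ht⟩ := ContinuousFunctionalCalculus.spectrum_nonempty (R := ℝ) (x 0) (hx 0)
      exact ⟨t, Set.mem_iUnion.2 ⟨0, ht⟩⟩
  obtain ⟨m, hmK, hm⟩ := hKc.exists_isLeast hKne
  obtain ⟨M, hMK, hM⟩ := hKc.exists_isGreatest hKne
  have hJI : Set.Icc m M ⊆ I := hI.out (hKI hmK) (hKI hMK)
  have hxJ (i : Fin n) : spectrum ℝ (x i) ⊆ Set.Icc m M := fun t ht ↦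
    have htK : t ∈ K := Set.mem_iUnion.2 ⟨i, ht⟩
    ⟨hm htK, hM htK⟩
  have hmy : algebraMap ℝ A m ≤ y := by
    have h := affine_sum_conjugate_le (z := 0) (c := -1) (d := m) (x := x) ha fun i ↦ by
      simpa using algebraMap_le_of_le_spectrum (fun t ht ↦ (hxJ i ht).1) (hx i)
    simpa using h
  have hyM : y ≤ algebraMap ℝ A M := by
    have h := affine_sum_conjugate_le (z := 0) (c := 1) (d := -M) (x := x) ha fun i ↦ by
      simpa using le_algebraMap_of_spectrum_le (fun t ht ↦ (hxJ i ht).2) (hx i)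
    simpa using h
  refine tracial_cfc_le_of_affine_le τ hτpos hτtrace isCompact_Icc (hf.mono hJI)
    (hconv.subset hJI (convex_Icc m M)) hy
    (fun t ht ↦ ⟨(algebraMap_le_iff_le_spectrum hy).1 hmy t ht,
      (le_algebraMap_iff_spectrum_le hy).1 hyM t ht⟩)
    fun c d hcd ↦ affine_sum_conjugate_le ha fun i ↦ ?_
  have haff : cfc (fun t ↦ c * t + d) (x i) = c • x i + algebraMap ℝ A d := by
    rw [cfc_add_const d (fun t ↦ c * t) (x i), cfc_const_mul_id c (x i)]
  rw [← haff]
  exact cfc_mono (fun t ht ↦ hcd t (hxJ i ht)) (by fun_prop) (hf.mono (hxI i))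
end

section
/- Let f be a continuous convex real function on an interval I ⊆ ℝ, let A be a unital C*-algebra, let (x_1, …, x_n) be self-adjoint elements of A with spectra contained in I, and let (a_1, …, a_n) be elements of A with Σ_{k=1}^n a_k* a_k = 1. Set y = Σ_{k=1}^n a_k* x_k a_k, and let φ : A → ℂ be a positive linear functional such that y lies in the centralizer of φ, i.e., φ(x y) = φ(y x) for all x ∈ A. Then φ(f(y)) ≤ φ(Σ_{k=1}^n a_k* f(x_k) a_k). -/
open scoped ComplexOrder

/-- A continuous convex function on a compact set of reals is approximated from below, up to `ε`,
by a convex combination of affine minorants whose coefficients are squares of nonnegative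
continuous functions. -/
lemma ConvexOn.exists_partition_affine_le {K : Set ℝ} (hK : IsCompact K) {f : ℝ → ℝ}
    (hf : ContinuousOn f K) (hconv : ConvexOn ℝ K f) {ε : ℝ} (hε : 0 < ε) :
    ∃ (t : Finset ℝ) (c d : ℝ → ℝ) (q : ℝ → ℝ → ℝ),
      (∀ j ∈ t, ∀ s ∈ K, c j * s + d j ≤ f s) ∧
      (∀ j, ContinuousOn (q j) K) ∧
      (∀ s ∈ K, ∑ j ∈ t, q j s * q j s = 1) ∧
      ∀ s ∈ K, f s - ε ≤ ∑ j ∈ t, q j s * (c j * s + d j) * q j s := by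
  have key : ∀ r : ℝ, ∃ c d : ℝ, r ∈ K →
      (∀ s ∈ K, c * s + d ≤ f s) ∧ f r - ε < c * r + d := by
    intro r
    by_cases hr : r ∈ K
    · obtain ⟨c, d, h1, h2⟩ := hconv.exists_affine_le_of_lt_real (a := f r - ε / 2) hr
        (by linarith) hK.isClosed hf.lowerSemicontinuousOn
      exact ⟨c, d, fun _ ↦ ⟨h1, by linarith⟩⟩
    · exact ⟨0, 0, fun h ↦ absurd h hr⟩
  choose c d hcd using key
  let w : ℝ → ℝ → ℝ := fun j s ↦ max (c j * s + d j - f s + ε) 0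
  have hw : ∀ j, ContinuousOn (w j) K := fun j ↦ by fun_prop
  have hw0 : ∀ j s, 0 ≤ w j s := fun j s ↦ le_max_right _ _
  obtain ⟨t, htK, ht⟩ := hK.elim_nhdsWithin_subcover (fun j ↦ {s | 0 < w j s}) (fun r hr ↦
    (hw r r hr).eventually_const_lt (lt_max_of_lt_left (by linarith [(hcd r hr).2])))
  have hpos : ∀ s ∈ K, 0 < ∑ j ∈ t, w j s := by
    intro s hs
    obtain ⟨j, hj, hjs⟩ := Set.mem_iUnion₂.mp (ht hs)
    exact Finset.sum_pos' (fun i _ ↦ hw0 i s) ⟨j, hj, hjs⟩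
  let q : ℝ → ℝ → ℝ := fun j s ↦ √(w j s / ∑ i ∈ t, w i s)
  have hqq : ∀ j, ∀ s ∈ K, q j s * q j s = w j s / ∑ i ∈ t, w i s := fun j s hs ↦
    Real.mul_self_sqrt (div_nonneg (hw0 j s) (hpos s hs).le)
  refine ⟨t, c, d, q, fun j hj ↦ (hcd j (htK j hj)).1, fun j ↦ ?_, fun s hs ↦ ?_, fun s hs ↦ ?_⟩
  · exact ((hw j).div (continuousOn_finsetSum t fun i _ ↦ hw i)
      fun s hs ↦ (hpos s hs).ne').sqrt
  · rw [Finset.sum_congr rfl fun j _ ↦ hqq j s hs, ← Finset.sum_div, div_self (hpos s hs).ne']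
  · have h1 : ∀ j, q j s * (c j * s + d j) * q j s
        = (w j s * (c j * s + d j)) / ∑ i ∈ t, w i s := fun j ↦ by
      rw [mul_right_comm, hqq j s hs]
      ring
    simp_rw [h1]
    rw [← Finset.sum_div, le_div_iff₀ (hpos s hs), Finset.mul_sum]
    refine Finset.sum_le_sum fun j _ ↦ ?_
    rcases (hw0 j s).eq_or_lt with h | h
    · simp [← h]
    · have h2 : 0 < c j * s + d j - f s + ε := by
        by_contra hcon
        exact h.ne' (max_eq_right (not_lt.mp hcon))
      nlinarith

section CStarAlgebra

variable {A : Type*} [CStarAlgebra A]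

/-- If `y` lies in the centralizer of a continuous functional, so does every `f(y)`. -/
lemma map_mul_cfc_comm {φ : A →ₗ[ℂ] ℂ} (hφ : Continuous φ) {y : A} (hy : IsSelfAdjoint y)
    (h : ∀ z, φ (z * y) = φ (y * z)) (f : ℝ → ℝ) (z : A) :
    φ (z * cfc f y) = φ (cfc f y * z) := by
  have hmem : cfc f y ∈ StarAlgebra.elemental ℝ y := cfc_mem_elemental f y
  generalize cfc f y = b at hmem ⊢
  induction hmem using StarAlgebra.elemental.induction_on generalizing z with
  | self => exact h z
  | star_self => rw [hy.star_eq]; exact h z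
  | algebraMap r => rw [Algebra.commutes]
  | add u _ v _ hu hv => rw [mul_add, add_mul, map_add, map_add, hu, hv]
  | mul u _ v _ hu hv => rw [← mul_assoc, hv, ← mul_assoc, hu, mul_assoc]
  | closure s _ hs v hv =>
    exact closure_minimal (s := s) (t := {v | φ (z * v) = φ (v * z)}) (fun u hu ↦ hs u hu z)
      (isClosed_eq (by fun_prop) (by fun_prop)) hv

variable [PartialOrder A] [StarOrderedRing A]

/-- A positive linear functional on a unital C*-algebra is monotone and continuous. -/
lemma LinearMap.monotone_and_continuous_of_star_mul_self_nonneg {φ : A →ₗ[ℂ] ℂ}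
    (hφ : ∀ a, 0 ≤ φ (star a * a)) : Monotone φ ∧ Continuous φ := by
  let ψ : A →ₚ[ℂ] ℂ := PositiveLinearMap.mk₀ φ fun x hx ↦ by
    obtain ⟨b, rfl⟩ := CStarAlgebra.nonneg_iff_eq_star_mul_self.mp hx
    exact hφ b
  exact ⟨ψ.monotone', map_continuous ψ⟩

variable {ι : Type*} [Fintype ι] {x a : ι → A}

/-- Jensen's operator inequality for an affine minorant. -/
lemma affine_sum_conjugate_le_s17 (hx : ∀ i, IsSelfAdjoint (x i)) (ha : ∑ k, star (a k) * a k = 1)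
    {f : ℝ → ℝ} (hf : ∀ i, ContinuousOn f (spectrum ℝ (x i))) {c d : ℝ}
    (hle : ∀ i, ∀ s ∈ spectrum ℝ (x i), c * s + d ≤ f s) :
    c • (∑ k, star (a k) * x k * a k) + algebraMap ℝ A d
      ≤ ∑ k, star (a k) * cfc f (x k) * a k := by
  have h1 : c • (∑ k, star (a k) * x k * a k) + algebraMap ℝ A d
      = ∑ k, star (a k) * (c • x k + algebraMap ℝ A d) * a k := by
    simp only [mul_add, add_mul, Finset.sum_add_distrib, Finset.smul_sum, mul_smul_comm,
      smul_mul_assoc, Algebra.algebraMap_eq_smul_one, mul_one]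
    rw [← Finset.smul_sum (f := fun k ↦ star (a k) * a k), ha]
  rw [h1]
  refine Finset.sum_le_sum fun k _ ↦ star_left_conjugate_le_conjugate ?_ _
  have h2 : cfc (fun s ↦ c * s + d) (x k) = c • x k + algebraMap ℝ A d := by
    rw [cfc_add_const d (fun s ↦ c * s) (x k) (by fun_prop) (hx k),
      cfc_const_mul_id c (x k) (hx k)]
  rw [← h2]
  exact cfc_mono (hle k) (by fun_prop) (hf k)

omit [PartialOrder A] [StarOrderedRing A] in
lemma isSelfAdjoint_sum_conjugate (hx : ∀ i, IsSelfAdjoint (x i)) :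
    IsSelfAdjoint (∑ k, star (a k) * x k * a k) :=
  isSelfAdjoint_sum _ fun k _ ↦ (hx k).conjugate' (a k)

lemma spectrum_sum_conjugate_subset_Icc (hx : ∀ i, IsSelfAdjoint (x i))
    (ha : ∑ k, star (a k) * a k = 1) {m M : ℝ} (h : ∀ i, spectrum ℝ (x i) ⊆ Set.Icc m M) :
    spectrum ℝ (∑ k, star (a k) * x k * a k) ⊆ Set.Icc m M := by
  have hy := isSelfAdjoint_sum_conjugate (a := a) hx
  have hlow := affine_sum_conjugate_le_s17 hx ha (f := id) (c := 0) (d := m)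
    (fun i ↦ continuousOn_id) (fun i s hs ↦ by simpa using (h i hs).1)
  have hup := affine_sum_conjugate_le_s17 hx ha (f := fun s ↦ -s) (c := 0) (d := -M)
    (fun i ↦ by fun_prop) (fun i s hs ↦ by simpa using (h i hs).2)
  simp only [zero_smul, zero_add, cfc_id ℝ _ (hx _)] at hlow
  simp only [zero_smul, zero_add, cfc_neg_id _ (hx _), mul_neg, neg_mul, Finset.sum_neg_distrib,
    map_neg, neg_le_neg_iff] at hup
  exact fun s hs ↦ ⟨(algebraMap_le_iff_le_spectrum hy).mp hlow s hs,
    (le_algebraMap_iff_spectrum_le hy).mp hup s hs⟩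

/-- If `p` dominates all affine minorants of a convex `f` evaluated at `y`, and `y` is in the
centralizer of the positive functional `φ`, then `φ(f(y)) ≤ φ(p)`. -/
lemma map_cfc_le_of_forall_affine_le {φ : A →ₗ[ℂ] ℂ} (hφ : ∀ a, 0 ≤ φ (star a * a)) {y p : A}
    (hy : IsSelfAdjoint y) (hcomm : ∀ z, φ (z * y) = φ (y * z)) {K : Set ℝ} (hK : IsCompact K)
    (hyK : spectrum ℝ y ⊆ K) {f : ℝ → ℝ} (hf : ContinuousOn f K) (hconv : ConvexOn ℝ K f)
    (hp : ∀ c d : ℝ, (∀ s ∈ K, c * s + d ≤ f s) → c • y + algebraMap ℝ A d ≤ p) :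
    φ (cfc f y) ≤ φ p := by
  obtain ⟨hmono, hcont⟩ := LinearMap.monotone_and_continuous_of_star_mul_self_nonneg hφ
  have hfy := hf.mono hyK
  have main : ∀ ε : ℝ, 0 < ε → φ (cfc f y - algebraMap ℝ A ε) ≤ φ p := by
    intro ε hε
    obtain ⟨t, c, d, q, hle, hq, hsum, happrox⟩ :=
      hconv.exists_partition_affine_le hK hf hε
    have hqy : ∀ j, ContinuousOn (q j) (spectrum ℝ y) := fun j ↦ (hq j).mono hyK
    have hl : ∀ j, cfc (fun s ↦ c j * s + d j) y = c j • y + algebraMap ℝ A (d j) := fun j ↦ by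
      rw [cfc_add_const (d j) (fun s ↦ c j * s) y (by fun_prop) hy, cfc_const_mul_id (c j) y hy]
    have hone : ∑ j ∈ t, cfc (q j) y * cfc (q j) y = 1 := by
      rw [← cfc_const_one ℝ y, ← cfc_congr (f := fun s ↦ ∑ j ∈ t, q j s * q j s)
        (fun s hs ↦ hsum s (hyK hs)), ← Finset.sum_fn,
        cfc_sum _ _ _ (fun j _ ↦ by have := hqy j; fun_prop)]
      exact Finset.sum_congr rfl fun j _ ↦ (cfc_mul _ _ y (hqy j) (hqy j)).symm
    calc φ (cfc f y - algebraMap ℝ A ε)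
        = φ (cfc (fun s ↦ f s - ε) y) := by
          rw [cfc_sub f (fun _ ↦ ε) y hfy (by fun_prop), cfc_const ε y hy]
      _ ≤ φ (cfc (fun s ↦ ∑ j ∈ t, q j s * (c j * s + d j) * q j s) y) :=
          hmono (cfc_mono (fun s hs ↦ happrox s (hyK hs)) (by fun_prop)
            (continuousOn_finsetSum t fun j _ ↦ by have := hqy j; fun_prop))
      _ = ∑ j ∈ t, φ (cfc (q j) y * (c j • y + algebraMap ℝ A (d j)) * cfc (q j) y) := by
          rw [← Finset.sum_fn, cfc_sum _ _ _ (fun j _ ↦ by have := hqy j; fun_prop), map_sum]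
          refine Finset.sum_congr rfl fun j _ ↦ ?_
          have := hqy j
          rw [cfc_mul _ _ y (by fun_prop) (by fun_prop), cfc_mul _ _ y (by fun_prop) (by fun_prop),
            hl]
      _ ≤ ∑ j ∈ t, φ (cfc (q j) y * p * cfc (q j) y) := by
          refine Finset.sum_le_sum fun j hj ↦ hmono ?_
          exact (cfc_predicate (q j) y : IsSelfAdjoint _).conjugate_le_conjugate
            (hp _ _ (hle j hj))
      _ = φ p := by
          simp_rw [mul_assoc, ← map_mul_cfc_comm hcont hy hcomm, mul_assoc]
          rw [← map_sum, ← Finset.mul_sum, hone, mul_one]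
  have hlim : Filter.Tendsto (fun ε : ℝ ↦ φ (cfc f y - algebraMap ℝ A ε))
      (nhdsWithin 0 (Set.Ioi 0)) (nhds (φ (cfc f y))) := by
    have : Continuous fun ε : ℝ ↦ φ (cfc f y - algebraMap ℝ A ε) := by fun_prop
    simpa using (this.tendsto 0).mono_left nhdsWithin_le_nhds
  exact le_of_tendsto hlim (Filter.eventually_of_mem self_mem_nhdsWithin main)

end CStarAlgebra

/-- **Theorem 4.1 (discrete case).**  Let `f` be a continuous convex function on an interval
`I ⊆ ℝ`, let `A` be a unital C*-algebra, let `(x₁, …, xₙ)` be self-adjoint elements of `A`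
with spectra in `I`, and let `(a₁, …, aₙ)` be elements of `A` with `∑ aₖ* aₖ = 1`.  Set
`y = ∑ aₖ* xₖ aₖ` and let `φ : A → ℂ` be a positive linear functional containing `y` in its
centralizer, i.e. `φ(x y) = φ(y x)` for all `x ∈ A`.  Then `φ(f(y)) ≤ φ(∑ aₖ* f(xₖ) aₖ)`. -/
theorem jensen_inequality_centralizer
    (f : ℝ → ℝ) (I : Set ℝ) (hI : I.OrdConnected) (hf : ContinuousOn f I)
    (hconv : ConvexOn ℝ I f)
    (A : Type) [CStarAlgebra A]
    (n : ℕ) (x a : Fin n → A)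
    (hx : ∀ i, IsSelfAdjoint (x i)) (hxI : ∀ i, spectrum ℝ (x i) ⊆ I)
    (ha : ∑ k, star (a k) * a k = 1)
    (y : A) (hy : y = ∑ k, star (a k) * x k * a k)
    (φ : A →ₗ[ℂ] ℂ) (hφpos : ∀ a : A, 0 ≤ φ (star a * a))
    (hφcentral : ∀ z : A, φ (z * y) = φ (y * z)) :
    φ (cfc f y) ≤ φ (∑ k, star (a k) * cfc f (x k) * a k) := by
  let _ := CStarAlgebra.spectralOrder A
  let _ := CStarAlgebra.spectralOrderedRing A
  rcases subsingleton_or_nontrivial A with _ | _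
  · exact (congrArg φ (Subsingleton.elim _ _)).le
  have hne : (⋃ i, spectrum ℝ (x i)).Nonempty := by
    rcases isEmpty_or_nonempty (Fin n) with _ | ⟨⟨i⟩⟩
    · simp at ha
    · exact (ContinuousFunctionalCalculus.spectrum_nonempty (R := ℝ) (x i) (hx i)).mono
        (Set.subset_iUnion _ i)
  have hcompact : IsCompact (⋃ i, spectrum ℝ (x i)) :=
    isCompact_iUnion fun i ↦ spectrum.isCompact (x i)
  obtain ⟨m, hm⟩ := hcompact.exists_isLeast hne
  obtain ⟨M, hM⟩ := hcompact.exists_isGreatest hne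
  have hsub : ∀ i, spectrum ℝ (x i) ⊆ Set.Icc m M := fun i s hs ↦
    ⟨hm.2 (Set.mem_iUnion_of_mem i hs), hM.2 (Set.mem_iUnion_of_mem i hs)⟩
  have hUI : (⋃ i, spectrum ℝ (x i)) ⊆ I := Set.iUnion_subset hxI
  have hKI : Set.Icc m M ⊆ I := hI.out (hUI hm.1) (hUI hM.1)
  subst hy
  refine map_cfc_le_of_forall_affine_le hφpos (isSelfAdjoint_sum_conjugate hx) hφcentral
    isCompact_Icc (spectrum_sum_conjugate_subset_Icc hx ha hsub) (hf.mono hKI)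
    (hconv.subset hKI (convex_Icc m M)) fun c d hcd ↦ ?_
  exact affine_sum_conjugate_le_s17 hx ha (fun i ↦ hf.mono (hxI i)) fun i s hs ↦ hcd s (hsub i hs)
end
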